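/- Let u : ℝ³ → ℝ be a smooth compactly supported function and define φ_u(x) = (1/(4π)) ∫_{ℝ³} u(y)² / ‖x − y‖ dy. Then φ_u is differentiable, both integrals below are finite, and ∫_{ℝ³} ‖∇φ_u(x)‖² dx = ∫_{ℝ³} φ_u(x) u(x)² dx. -/

import Mathlib

open MeasureTheory

open Filter Topology Metric
open scoped ContDiff

/-- Three-dimensional Euclidean space. -/
abbrev NPE := EuclideanSpace ℝ (Fin 3)

/-- Partial derivative in the `i`-th coordinate direction. -/
noncomputable def npD (i : Fin 3) (f : NPE → ℝ) : NPE → ℝ :=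
  fun x => fderiv ℝ f x (EuclideanSpace.single i 1)

lemma npD_contDiff {f : NPE → ℝ} (hf : ContDiff ℝ ∞ f) (i : Fin 3) : ContDiff ℝ ∞ (npD i f) := by
  have : ContDiff ℝ ∞ (fderiv ℝ f) := hf.fderiv_right (by simp)
  exact this.clm_apply contDiff_const

lemma npD_supp {f : NPE → ℝ} (hf : HasCompactSupport f) (i : Fin 3) :
    HasCompactSupport (npD i f) := by
  have := hf.fderiv (𝕜 := ℝ)
  exact this.comp_left (g := fun L : NPE →L[ℝ] ℝ => L (EuclideanSpace.single i 1)) (by simp)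

lemma npInt_left {a h : NPE → ℝ} (ha : Continuous a) (hh : Continuous h)
    (hs : HasCompactSupport h) : Integrable (fun x => a x * h x) :=
  (ha.mul hh).integrable_of_hasCompactSupport hs.mul_left

lemma npParts {a h : NPE → ℝ} (ha : ContDiff ℝ ∞ a) (hh : ContDiff ℝ ∞ h)
    (hs : HasCompactSupport h) (i : Fin 3) :
    ∫ x, a x * npD i h x = - ∫ x, npD i a x * h x := by
  apply integral_mul_fderiv_eq_neg_fderiv_mul_of_integrable
  · exact npInt_left (npD_contDiff ha i).continuous hh.continuous hs
  · exact npInt_left ha.continuous (npD_contDiff hh i).continuous (npD_supp hs i)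
  · exact npInt_left ha.continuous hh.continuous hs
  · intro x _; exact (ha.differentiable (by simp)) x
  · intro x _; exact (hh.differentiable (by simp)) x

lemma npGreen {a h : NPE → ℝ} (ha : ContDiff ℝ ∞ a) (hh : ContDiff ℝ ∞ h)
    (hs : HasCompactSupport h) (i : Fin 3) :
    ∫ x, a x * npD i (npD i h) x = ∫ x, npD i (npD i a) x * h x := by
  rw [npParts ha (npD_contDiff hh i) (npD_supp hs i) i,
    npParts (npD_contDiff ha i) hh hs i, neg_neg]

lemma npIntegral_aux :
    ∫ z : NPE, 3 * (1 + ‖z‖ ^ 2) ^ (-(5:ℝ) / 2) = 4 * Real.pi := by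
  have hd : ∀ x ∈ Set.Ici (0:ℝ), HasDerivAt (fun y : ℝ => y ^ 3 * (1 + y ^ 2) ^ (-(3:ℝ) / 2))
      (x ^ 2 * (3 * (1 + x ^ 2) ^ (-(5:ℝ) / 2))) x := by
    intro x _
    have hp : 0 < 1 + x ^ 2 := by positivity
    have h1 : HasDerivAt (fun y : ℝ => 1 + y ^ 2) (2 * x) x := by
      simpa using (hasDerivAt_pow 2 x).const_add 1
    have h2 := h1.rpow_const (p := -(3:ℝ)/2) (Or.inl hp.ne')
    have h3 := (hasDerivAt_pow 3 x).mul h2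
    refine h3.congr_deriv ?_
    have e1 : (1 + x ^ 2) ^ (-(3:ℝ) / 2) = (1 + x ^ 2) * (1 + x ^ 2) ^ (-(5:ℝ) / 2) := by
      conv_rhs => rw [← Real.rpow_one_add' hp.le (by norm_num)]
      norm_num
    have e2 : -(3:ℝ) / 2 - 1 = -5 / 2 := by norm_num
    rw [e1, e2]
    norm_num
    ring
  have hlim : Tendsto (fun y : ℝ => y ^ 3 * (1 + y ^ 2) ^ (-(3:ℝ) / 2)) atTop (𝓝 1) := by
    have h1 : Tendsto (fun y : ℝ => (1 - (1 + y ^ 2)⁻¹) ^ ((3:ℝ) / 2)) atTop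
        (𝓝 ((1 - 0) ^ ((3:ℝ) / 2))) := by
      refine Tendsto.rpow_const (tendsto_const_nhds.sub ?_) (Or.inl (by norm_num))
      refine tendsto_inv_atTop_zero.comp ?_
      exact tendsto_atTop_add_const_left _ _ (tendsto_pow_atTop (by norm_num))
    norm_num at h1
    refine h1.congr' ?_
    filter_upwards [eventually_gt_atTop 0] with y hy
    have hp : 0 < 1 + y ^ 2 := by positivity
    have e : 1 - (1 + y ^ 2)⁻¹ = y ^ 2 / (1 + y ^ 2) := by field_simp; ring
    rw [e, Real.div_rpow (by positivity) hp.le, neg_div, Real.rpow_neg hp.le, div_eq_mul_inv]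
    congr 1
    rw [← Real.rpow_natCast, ← Real.rpow_mul hy.le, ← Real.rpow_natCast]
    norm_num
  have hI : ∫ x in Set.Ioi (0:ℝ), x ^ 2 * (3 * (1 + x ^ 2) ^ (-(5:ℝ) / 2)) = 1 := by
    rw [integral_Ioi_of_hasDerivAt_of_nonneg' hd (fun x _ => by positivity) hlim]
    norm_num
  have := integral_fun_norm_addHaar (volume : Measure NPE)
    (fun r : ℝ => 3 * (1 + r ^ 2) ^ (-(5:ℝ) / 2))
  rw [this]
  have hv : (volume : Measure NPE).real (ball 0 1) = 4 * Real.pi / 3 := by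
    rw [Measure.real, InnerProductSpace.volume_ball_of_dim_odd (k := 1) (by simp)]
    simp
    rw [ENNReal.toReal_ofReal (by positivity)]; ring
  rw [hv]
  simp only [finrank_euclideanSpace, Fintype.card_fin, smul_eq_mul, nsmul_eq_mul]
  norm_num at hI ⊢
  rw [hI]; ring

/-- Regularised kernel. -/
noncomputable def npQ (e : ℝ) (p : ℝ) : NPE → ℝ := fun t => (‖t‖ ^ 2 + e ^ 2) ^ p

lemma npQ_contDiff {e : ℝ} (he : 0 < e) (p : ℝ) : ContDiff ℝ ∞ (npQ e p) := by
  unfold npQ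
  refine ContDiff.rpow_const_of_ne ((contDiff_norm_sq ℝ).add contDiff_const) ?_
  intro x; positivity

lemma npD_npQ {e : ℝ} (he : 0 < e) (p : ℝ) (i : Fin 3) (t : NPE) :
    npD i (npQ e p) t = 2 * p * t i * npQ e (p - 1) t := by
  have hp : 0 < ‖t‖ ^ 2 + e ^ 2 := by positivity
  have h1 : HasFDerivAt (fun t : NPE => ‖t‖ ^ 2 + e ^ 2) (2 • (innerSL ℝ t)) t := by
    have := (hasStrictFDerivAt_norm_sq t).hasFDerivAt.add_const (e ^ 2)
    simpa using this
  have h2 := h1.rpow_const (p := p) (Or.inl hp.ne')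
  unfold npD npQ
  rw [h2.fderiv]
  simp [EuclideanSpace.inner_single_right]
  ring

lemma npD_coord (i : Fin 3) (t : NPE) : HasFDerivAt (fun t : NPE => t i)
    (EuclideanSpace.proj (𝕜 := ℝ) i : NPE →L[ℝ] ℝ) t :=
  (EuclideanSpace.proj (𝕜 := ℝ) i : NPE →L[ℝ] ℝ).hasFDerivAt

lemma npD2_npQ {e : ℝ} (he : 0 < e) (i : Fin 3) (t : NPE) :
    npD i (npD i (npQ e (-1/2))) t =
      - npQ e (-3/2) t + 3 * (t i) ^ 2 * npQ e (-5/2) t := by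
  have : npD i (npQ e (-1/2)) = fun t => (-(t i)) * npQ e (-3/2) t := by
    funext s; rw [npD_npQ he]; norm_num
  rw [this]
  have h1 : HasFDerivAt (npQ e (-3/2)) (fderiv ℝ (npQ e (-3/2)) t) t :=
    ((npQ_contDiff he _).differentiable (by simp) t).hasFDerivAt
  have h2 : HasFDerivAt (fun t : NPE => (-(t i)) * npQ e (-3/2) t) _ t :=
    (npD_coord i t).neg.mul h1
  have h3 := npD_npQ he (-3/2) i t
  unfold npD at h3 ⊢
  rw [HasFDerivAt.fderiv h2]
  simp [h3]
  norm_num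
  ring

lemma npLap_npQ {e : ℝ} (he : 0 < e) (t : NPE) :
    ∑ i, npD i (npD i (npQ e (-1/2))) t = - (3 * e ^ 2 * npQ e (-5/2) t) := by
  simp only [npD2_npQ he]
  have hp : 0 < ‖t‖ ^ 2 + e ^ 2 := by positivity
  have e1 : npQ e (-3/2) t = (‖t‖ ^ 2 + e ^ 2) * npQ e (-5/2) t := by
    unfold npQ
    conv_rhs => rw [← Real.rpow_one_add' hp.le (by norm_num)]
    norm_num
  have e2 : ‖t‖ ^ 2 = t 0 ^ 2 + t 1 ^ 2 + t 2 ^ 2 := by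
    rw [EuclideanSpace.norm_sq_eq]; simp [Fin.sum_univ_three]
  rw [Fin.sum_univ_three, e1, e2]
  ring

lemma npLI : LocallyIntegrable (fun t : NPE => ‖t‖⁻¹) := by
  refine locallyIntegrable_of_norm_le_rpow (C := 1) (α := 1) (by simp) (by simp) ?_ ?_
  · filter_upwards with x
    simp [Real.rpow_neg_one]
  · exact (measurable_norm.inv).aestronglyMeasurable

lemma npInt_ker {h : NPE → ℝ} (hc : Continuous h) (hs : HasCompactSupport h) :
    Integrable (fun t : NPE => ‖t‖⁻¹ * h t) := by
  have := npLI.integrable_smul_right_of_hasCompactSupport hc hs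
  simpa using this

lemma npScale {h : NPE → ℝ} {e : ℝ} (he : 0 < e) :
    ∫ t, 3 * e ^ 2 * npQ e (-5/2) t * h t =
      ∫ z : NPE, 3 * (1 + ‖z‖ ^ 2) ^ (-(5:ℝ) / 2) * h (e • z) := by
  have h1 := Measure.integral_comp_smul (volume : Measure NPE)
    (fun t => 3 * e ^ 2 * npQ e (-5/2) t * h t) e
  have h2 : ∀ z : NPE, 3 * e ^ 2 * npQ e (-5/2) (e • z) * h (e • z) =
      (e ^ 3)⁻¹ * (3 * (1 + ‖z‖ ^ 2) ^ (-(5:ℝ) / 2) * h (e • z)) := by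
    intro z
    have e1 : ‖e • z‖ ^ 2 + e ^ 2 = e ^ 2 * (1 + ‖z‖ ^ 2) := by
      rw [norm_smul, Real.norm_of_nonneg he.le]; ring
    have e2 : (e ^ 2) ^ (-(5:ℝ) / 2) = (e ^ 5)⁻¹ := by
      rw [← Real.rpow_natCast, ← Real.rpow_mul he.le, ← Real.rpow_natCast, ← Real.rpow_neg he.le]
      norm_num
    unfold npQ
    rw [e1, Real.mul_rpow (by positivity) (by positivity), e2]
    field_simp
  simp only [h2] at h1
  rw [integral_const_mul] at h1
  simp only [finrank_euclideanSpace, Fintype.card_fin, smul_eq_mul] at h1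
  rw [abs_of_pos (by positivity)] at h1
  have h3 : (e ^ 3)⁻¹ ≠ 0 := by positivity
  exact (mul_left_cancel₀ h3 h1).symm

lemma npFund {h : NPE → ℝ} (hh : ContDiff ℝ ∞ h) (hs : HasCompactSupport h) :
    ∫ t : NPE, ‖t‖⁻¹ * ∑ i, npD i (npD i h) t = -(4 * Real.pi * h 0) := by
  have hc : ∀ i, Continuous (npD i (npD i h)) := fun i =>
    (npD_contDiff (npD_contDiff hh i) i).continuous
  have hcs : ∀ i, HasCompactSupport (npD i (npD i h)) := fun i => npD_supp (npD_supp hs i) i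
  have hC : Continuous (fun t => ∑ i, npD i (npD i h) t) := continuous_finsetSum _ fun i _ => hc i
  -- identity for the regularised kernel
  have key : ∀ e : ℝ, 0 < e → ∫ t, npQ e (-1/2) t * ∑ i, npD i (npD i h) t =
      - ∫ z : NPE, 3 * (1 + ‖z‖ ^ 2) ^ (-(5:ℝ) / 2) * h (e • z) := by
    intro e he
    have hQ := npQ_contDiff he (-1/2)
    rw [← npScale he, ← integral_neg]
    simp only [Finset.mul_sum]
    rw [integral_finsetSum _ fun i _ => npInt_left hQ.continuous (hc i) (hcs i)]
    simp only [npGreen hQ hh hs]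
    rw [← integral_finsetSum _ fun i _ => npInt_left
      (npD_contDiff (npD_contDiff hQ i) i).continuous hh.continuous hs]
    congr 1; funext t
    rw [← Finset.sum_mul, npLap_npQ he]; ring
  -- limit of the left-hand side
  have l1 : Tendsto (fun e : ℝ => ∫ t, npQ e (-1/2) t * ∑ i, npD i (npD i h) t) (𝓝[>] 0)
      (𝓝 (∫ t : NPE, ‖t‖⁻¹ * ∑ i, npD i (npD i h) t)) := by
    refine tendsto_integral_filter_of_dominated_convergence
      (fun t => ‖t‖⁻¹ * ∑ i, ‖npD i (npD i h) t‖) ?_ ?_ ?_ ?_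
    · filter_upwards [self_mem_nhdsWithin] with e he
      exact ((npQ_contDiff he _).continuous.mul hC).aestronglyMeasurable
    · filter_upwards [self_mem_nhdsWithin] with e he
      have h0 : ∀ᵐ t : NPE, t ≠ 0 := by
        simp [ae_iff]
      filter_upwards [h0] with t ht
      have ht' : 0 < ‖t‖ := norm_pos_iff.mpr ht
      rw [norm_mul]
      refine mul_le_mul ?_ (norm_sum_le _ _) (norm_nonneg _) (by positivity)
      unfold npQ
      rw [Real.norm_of_nonneg (by positivity)]
      have : ‖t‖⁻¹ = (‖t‖ ^ 2) ^ (-1/2 : ℝ) := by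
        rw [← Real.rpow_natCast, ← Real.rpow_mul ht'.le, ← Real.rpow_neg_one]; norm_num
      rw [this]
      exact Real.rpow_le_rpow_of_nonpos (by positivity) (by nlinarith) (by norm_num)
    · simp only [Finset.mul_sum]
      refine integrable_finsetSum _ fun i _ => npInt_ker (hc i).norm (hcs i).norm
    · have h0 : ∀ᵐ t : NPE, t ≠ 0 := by
        simp [ae_iff]
      filter_upwards [h0] with t ht
      have ht' : 0 < ‖t‖ := norm_pos_iff.mpr ht
      refine Tendsto.mul_const _ ?_
      have : ‖t‖⁻¹ = (‖t‖ ^ 2 + 0 ^ 2) ^ (-1/2 : ℝ) := by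
        rw [zero_pow (by norm_num), add_zero,
          ← Real.rpow_natCast, ← Real.rpow_mul ht'.le, ← Real.rpow_neg_one]; norm_num
      rw [this]
      refine tendsto_nhdsWithin_of_tendsto_nhds ?_
      refine Tendsto.rpow_const ?_ (Or.inl (by positivity))
      exact (continuous_const.add (continuous_id.pow 2)).tendsto 0
  obtain ⟨C, hCb⟩ := hs.exists_bound_of_continuous hh.continuous
  have hint : Integrable (fun z : NPE => 3 * (1 + ‖z‖ ^ 2) ^ (-(5:ℝ) / 2)) :=
    (integrable_rpow_neg_one_add_norm_sq (by simp; norm_num)).const_mul 3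
  have l2 : Tendsto (fun e : ℝ => ∫ z : NPE, 3 * (1 + ‖z‖ ^ 2) ^ (-(5:ℝ) / 2) * h (e • z)) (𝓝[>] 0)
      (𝓝 (∫ z : NPE, 3 * (1 + ‖z‖ ^ 2) ^ (-(5:ℝ) / 2) * h 0)) := by
    refine tendsto_integral_filter_of_dominated_convergence
      (fun z => 3 * (1 + ‖z‖ ^ 2) ^ (-(5:ℝ) / 2) * C) ?_ ?_ (hint.mul_const _) ?_
    · refine Eventually.of_forall fun e => ?_
      refine hint.1.mul (hh.continuous.comp (continuous_const_smul e)).aestronglyMeasurable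
    · refine Eventually.of_forall fun e => Eventually.of_forall fun z => ?_
      rw [norm_mul, Real.norm_of_nonneg (by positivity)]
      exact mul_le_mul_of_nonneg_left (hCb _) (by positivity)
    · refine Eventually.of_forall fun z => Tendsto.const_mul _ ?_
      refine tendsto_nhdsWithin_of_tendsto_nhds ?_
      have : Continuous (fun e : ℝ => h (e • z)) :=
        hh.continuous.comp (continuous_id.smul continuous_const)
      simpa using this.tendsto 0
  rw [integral_mul_const, npIntegral_aux] at l2
  refine tendsto_nhds_unique l1 (l2.neg.congr' ?_)
  filter_upwards [self_mem_nhdsWithin] with e he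
  exact (key e he).symm

/-- Convolution with `1 / ‖x‖`. -/
noncomputable def npN (f : NPE → ℝ) : NPE → ℝ := fun x => ∫ t, ‖t‖⁻¹ * f (x - t)

lemma npN_eq_conv (f : NPE → ℝ) :
    npN f = convolution (fun t : NPE => ‖t‖⁻¹) f (ContinuousLinearMap.mul ℝ ℝ) volume := by
  funext x; simp [npN, convolution_def]

lemma npN_contDiff {f : NPE → ℝ} (hf : ContDiff ℝ ∞ f) (hs : HasCompactSupport f) :
    ContDiff ℝ ∞ (npN f) := by
  rw [npN_eq_conv]
  exact hs.contDiff_convolution_right _ npLI hf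

lemma npD_npN {f : NPE → ℝ} (hf : ContDiff ℝ ∞ f) (hs : HasCompactSupport f) (i : Fin 3) :
    npD i (npN f) = npN (npD i f) := by
  funext x
  have hf1 : ContDiff ℝ 1 f := hf.of_le (by exact_mod_cast le_top)
  rw [npN_eq_conv, npN_eq_conv]
  have := hs.hasFDerivAt_convolution_right (ContinuousLinearMap.mul ℝ ℝ) npLI hf1 x
  unfold npD
  rw [this.fderiv, convolution_precompR_apply _ npLI (hs.fderiv ℝ)
    (hf1.continuous_fderiv one_ne_zero)]

lemma npD_reflect {f : NPE → ℝ} (hf : ContDiff ℝ ∞ f) (x : NPE) (i : Fin 3) (t : NPE) :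
    npD i (fun t => f (x - t)) t = - npD i f (x - t) := by
  have h1 := (hf.differentiable (by simp) (x - t)).hasFDerivAt
  have h2 : HasFDerivAt (fun t : NPE => x - t) (-ContinuousLinearMap.id ℝ NPE) t :=
    (hasFDerivAt_id t).const_sub x
  have h3 : HasFDerivAt (fun t => f (x - t)) _ t := h1.comp t h2
  unfold npD
  rw [h3.fderiv]; simp

lemma npD_neg (f : NPE → ℝ) (i : Fin 3) (t : NPE) :
    npD i (fun t => - f t) t = - npD i f t := by
  unfold npD; rw [fderiv_fun_neg]; rfl

lemma npLap_npN {f : NPE → ℝ} (hf : ContDiff ℝ ∞ f) (hs : HasCompactSupport f) (x : NPE) :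
    ∑ i, npD i (npD i (npN f)) x = -(4 * Real.pi * f x) := by
  have hh : ContDiff ℝ ∞ (fun t => f (x - t)) := hf.comp (contDiff_const.sub contDiff_id)
  have hhs : HasCompactSupport (fun t => f (x - t)) :=
    hs.comp_homeomorph (Homeomorph.subLeft x)
  have h1 := npFund hh hhs
  have h2 : ∀ i t, npD i (npD i (fun t => f (x - t))) t = npD i (npD i f) (x - t) := by
    intro i t
    have : npD i (fun t => f (x - t)) = fun t => - npD i f (x - t) := by
      funext s; exact npD_reflect hf x i s
    rw [this, npD_neg (fun t => npD i f (x - t)), npD_reflect (npD_contDiff hf i), neg_neg]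
  simp only [h2, sub_zero] at h1
  rw [← h1]
  simp only [Finset.mul_sum]
  rw [integral_finsetSum]
  · refine Finset.sum_congr rfl fun i _ => ?_
    rw [npD_npN hf hs, npD_npN (npD_contDiff hf i) (npD_supp hs i)]
    rfl
  · intro i _
    refine npInt_ker ?_ ?_
    · exact (npD_contDiff (npD_contDiff hf i) i).continuous.comp (continuous_const.sub continuous_id)
    · exact (npD_supp (npD_supp hs i) i).comp_homeomorph (Homeomorph.subLeft x)

lemma npN_swap (f : NPE → ℝ) (x : NPE) : npN f x = ∫ y, f y / ‖x - y‖ := by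
  unfold npN
  rw [← integral_sub_left_eq_self (fun y => f y / ‖x - y‖) volume x]
  congr 1; funext t; simp; ring

lemma npN_decay {f : NPE → ℝ} (hf : Continuous f) (hs : HasCompactSupport f) :
    ∃ C R : ℝ, 0 ≤ C ∧ 0 < R ∧ ∀ x, R ≤ ‖x‖ → |npN f x| ≤ C / ‖x‖ := by
  obtain ⟨r, hr, hr'⟩ := hs.isCompact.isBounded.exists_pos_norm_lt
  have hfi : Integrable f := hf.integrable_of_hasCompactSupport hs
  refine ⟨2 * ∫ y, |f y|, 2 * r, ?_, by positivity, ?_⟩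
  · have : 0 ≤ ∫ y, |f y| := integral_nonneg fun y => abs_nonneg _
    positivity
  intro x hx
  have hx0 : 0 < ‖x‖ := by linarith
  rw [npN_swap]
  have h1 : ‖∫ y, f y / ‖x - y‖‖ ≤ ∫ y, |f y| * (2 / ‖x‖) := by
    refine norm_integral_le_of_norm_le (hfi.abs.mul_const _) (Eventually.of_forall fun y => ?_)
    by_cases hy : f y = 0
    · simp [hy]
    have hy' : ‖y‖ < r := hr' y (subset_tsupport _ hy)
    have h2 : ‖x‖ / 2 ≤ ‖x - y‖ := by
      have := norm_sub_norm_le x y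
      linarith
    rw [norm_div, norm_norm, Real.norm_eq_abs, div_eq_mul_inv]
    refine mul_le_mul_of_nonneg_left ?_ (abs_nonneg _)
    rw [← inv_div]
    exact inv_anti₀ (by positivity) h2
  rw [integral_mul_const] at h1
  rw [Real.norm_eq_abs] at h1
  refine h1.trans (le_of_eq ?_)
  ring

lemma npD_const_mul {f : NPE → ℝ} (hf : ContDiff ℝ ∞ f) (c : ℝ) (i : Fin 3) :
    npD i (fun x => c * f x) = fun x => c * npD i f x := by
  funext x
  unfold npD
  rw [fderiv_const_mul (hf.differentiable (by simp) x)]; rfl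

lemma npD_mul {f g : NPE → ℝ} (hf : ContDiff ℝ ∞ f) (hg : ContDiff ℝ ∞ g) (i : Fin 3) :
    npD i (fun x => f x * g x) = fun x => f x * npD i g x + g x * npD i f x := by
  funext x
  unfold npD
  rw [fderiv_fun_mul (hf.differentiable (by simp) x) (hg.differentiable (by simp) x)]
  simp

lemma npD_add {f g : NPE → ℝ} (hf : ContDiff ℝ ∞ f) (hg : ContDiff ℝ ∞ g) (i : Fin 3) :
    npD i (fun x => f x + g x) = fun x => npD i f x + npD i g x := by
  funext x
  unfold npD
  rw [fderiv_fun_add (hf.differentiable (by simp) x) (hg.differentiable (by simp) x)]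
  simp

lemma npD2_sq {f : NPE → ℝ} (hf : ContDiff ℝ ∞ f) (i : Fin 3) (x : NPE) :
    npD i (npD i (fun x => f x * f x)) x = 2 * npD i f x ^ 2 + 2 * (f x * npD i (npD i f) x) := by
  have hd := npD_contDiff hf i
  rw [npD_mul hf hf, npD_add (hf.mul hd) (hf.mul hd), npD_mul hf hd]
  ring

lemma npD_smul {f : NPE → ℝ} (hf : ContDiff ℝ ∞ f) (c : ℝ) (i : Fin 3) :
    npD i (fun x => f (c • x)) = fun x => c * npD i f (c • x) := by
  funext x
  have h1 := (hf.differentiable (by simp) (c • x)).hasFDerivAt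
  have h2 : HasFDerivAt (fun t : NPE => c • t) (c • ContinuousLinearMap.id ℝ NPE) x :=
    (hasFDerivAt_id x).const_smul c
  have h3 : HasFDerivAt (fun t => f (c • t)) _ x := h1.comp x h2
  unfold npD
  rw [h3.fderiv]; simp

/-- Localised energy identity. -/
lemma npLocal {ψ χ F : NPE → ℝ} (hψ : ContDiff ℝ ∞ ψ) (hχ : ContDiff ℝ ∞ χ)
    (hs : HasCompactSupport χ) (hF : Continuous F)
    (hL : ∀ x, ∑ i, npD i (npD i ψ) x = - F x) :
    ∫ x, χ x * ∑ i, npD i ψ x ^ 2 =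
      (∫ x, χ x * (ψ x * F x)) + 1 / 2 * ∫ x, (ψ x * ψ x) * ∑ i, npD i (npD i χ) x := by
  have hψ2 : ContDiff ℝ ∞ (fun x => ψ x * ψ x) := hψ.mul hψ
  have hi1 : ∀ i, Integrable (fun x => ψ x * ψ x * npD i (npD i χ) x) := fun i =>
    npInt_left hψ2.continuous (npD_contDiff (npD_contDiff hχ i) i).continuous
      (npD_supp (npD_supp hs i) i)
  have hi2 : ∀ i, Integrable (fun x => npD i (npD i (fun x => ψ x * ψ x)) x * χ x) := fun i =>
    npInt_left (npD_contDiff (npD_contDiff hψ2 i) i).continuous hχ.continuous hs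
  have h1 : ∫ x, (ψ x * ψ x) * ∑ i, npD i (npD i χ) x =
      ∫ x, ∑ i, npD i (npD i (fun x => ψ x * ψ x)) x * χ x := by
    simp only [Finset.mul_sum]
    rw [integral_finsetSum _ fun i _ => hi1 i, integral_finsetSum _ fun i _ => hi2 i]
    exact Finset.sum_congr rfl fun i _ => npGreen hψ2 hχ hs i
  have hi3 : Integrable (fun x => χ x * (ψ x * F x)) := by
    have := npInt_left (hψ.continuous.mul hF) hχ.continuous hs
    exact this.congr (Eventually.of_forall fun x => mul_comm _ _)
  rw [h1, ← integral_const_mul, ← integral_add hi3 ((integrable_finsetSum _ fun i _ => hi2 i).const_mul _)]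
  congr 1; funext x
  simp only [npD2_sq hψ]
  have := hL x
  have e : F x = - ∑ i, npD i (npD i ψ) x := by rw [this]; ring
  rw [e]
  simp only [Fin.sum_univ_three]
  ring

lemma npGlobal {ψ F : NPE → ℝ} (hψ : ContDiff ℝ ∞ ψ) (hF : Continuous F)
    (hFs : HasCompactSupport F) (hL : ∀ x, ∑ i, npD i (npD i ψ) x = - F x)
    {C R : ℝ} (hC : 0 ≤ C) (hdec : ∀ x, R ≤ ‖x‖ → |ψ x| ≤ C / ‖x‖) :
    Integrable (fun x => ∑ i, npD i ψ x ^ 2) ∧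
      ∫ x, ∑ i, npD i ψ x ^ 2 = ∫ x, ψ x * F x := by
  let b : ContDiffBump (0 : NPE) := ⟨1, 2, by norm_num, by norm_num⟩
  have hb : ContDiff ℝ ∞ (b : NPE → ℝ) := b.contDiff
  have hbs : HasCompactSupport (b : NPE → ℝ) := b.hasCompactSupport
  set g : NPE → ℝ := fun x => ∑ i, npD i ψ x ^ 2 with hg
  have hgc : Continuous g := continuous_finsetSum _ fun i _ =>
    (npD_contDiff hψ i).continuous.pow 2
  have hg0 : ∀ x, 0 ≤ g x := fun x => Finset.sum_nonneg fun i _ => sq_nonneg _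
  let χ : ℕ → NPE → ℝ := fun n x => b ((n : ℝ)⁻¹ • x)
  have hχ : ∀ n, ContDiff ℝ ∞ (χ n) := fun n => hb.comp (contDiff_const_smul _)
  have hχ1 : ∀ n x, χ n x ≤ 1 := fun n x => b.le_one
  have hχ0 : ∀ n x, 0 ≤ χ n x := fun n x => b.nonneg
  have hχeq : ∀ n : ℕ, 0 < n → ∀ x, ‖x‖ ≤ n → χ n x = 1 := by
    intro n hn x hx
    apply b.one_of_mem_closedBall
    have hn' : (0:ℝ) < n := by exact_mod_cast hn
    rw [mem_closedBall_zero_iff, norm_smul, Real.norm_of_nonneg (by positivity),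
      inv_mul_le_iff₀ hn']
    show ‖x‖ ≤ n * (1:ℝ)
    simpa using hx
  have hχs : ∀ n : ℕ, 0 < n → HasCompactSupport (χ n) := by
    intro n hn
    have hn' : (n:ℝ)⁻¹ ≠ 0 := by positivity
    exact hbs.comp_homeomorph (Homeomorph.smulOfNeZero _ hn')
  have hχlim : ∀ x, Tendsto (fun n => χ n x) atTop (𝓝 1) := by
    intro x
    refine tendsto_const_nhds.congr' ?_
    filter_upwards [eventually_gt_atTop 0, tendsto_natCast_atTop_atTop.eventually_ge_atTop ‖x‖]
      with n hn hx
    exact (hχeq n hn x hx).symm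
  -- the Laplacian of the bump function
  set Lb : NPE → ℝ := fun x => ∑ i, npD i (npD i b) x with hLb
  have hLbi : Integrable Lb := integrable_finsetSum _ fun i _ =>
    (npD_contDiff (npD_contDiff hb i) i).continuous.integrable_of_hasCompactSupport
      (npD_supp (npD_supp hbs i) i)
  have hLb0 : ∀ x : NPE, ‖x‖ < 1 → Lb x = 0 := by
    intro x hx
    refine Finset.sum_eq_zero fun i _ => ?_
    have h0 : ∀ y ∈ ball (0 : NPE) 1, npD i b y = 0 := by
      intro y hy
      have := (b.eventuallyEq_one_of_mem_ball hy).fderiv_eq (𝕜 := ℝ)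
      unfold npD
      rw [this]; simp
    have h1 : npD i b =ᶠ[𝓝 x] fun _ => 0 := by
      filter_upwards [isOpen_ball.mem_nhds (show x ∈ ball (0 : NPE) 1 by simpa using hx)] with y hy
      exact h0 y hy
    have := h1.fderiv_eq (𝕜 := ℝ)
    rw [npD, this]; simp
  have hLχ : ∀ n x, ∑ i, npD i (npD i (χ n)) x = (n : ℝ)⁻¹ ^ 2 * Lb ((n : ℝ)⁻¹ • x) := by
    intro n x
    have hd : ∀ i, ContDiff ℝ ∞ (fun x => npD i b ((n : ℝ)⁻¹ • x)) := fun i =>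
      (npD_contDiff hb i).comp (contDiff_const_smul _)
    simp only [hLb, Finset.mul_sum]
    refine Finset.sum_congr rfl fun i _ => ?_
    rw [npD_smul hb, npD_const_mul (hd i), npD_smul (npD_contDiff hb i)]
    ring
  -- the error term
  have herr : Tendsto (fun n => ∫ x, (ψ x * ψ x) * ∑ i, npD i (npD i (χ n)) x) atTop (𝓝 0) := by
    have hb1 : Tendsto (fun n : ℕ => (n : ℝ)⁻¹ * (C ^ 2 * ∫ z, |Lb z|)) atTop (𝓝 0) := by
      simpa using (tendsto_inv_atTop_nhds_zero_nat (𝕜 := ℝ)).mul_const (C ^ 2 * ∫ z, |Lb z|)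
    refine squeeze_zero_norm' ?_ hb1
    filter_upwards [eventually_gt_atTop 0, tendsto_natCast_atTop_atTop.eventually_ge_atTop R]
      with n hn hR
    have hn' : (0:ℝ) < n := by exact_mod_cast hn
    simp only [hLχ]
    have hsc := Measure.integral_comp_inv_smul_of_nonneg (volume : Measure NPE)
      (fun z => |Lb z| * (C ^ 2 * (n:ℝ)⁻¹ ^ 4)) hn'.le
    have hi : Integrable (fun x => |Lb ((n:ℝ)⁻¹ • x)| * (C ^ 2 * (n:ℝ)⁻¹ ^ 4)) :=
      ((hLbi.comp_smul (inv_ne_zero hn'.ne')).abs).mul_const _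
    have hle : ‖∫ x, ψ x * ψ x * ((n : ℝ)⁻¹ ^ 2 * Lb ((n : ℝ)⁻¹ • x))‖ ≤
        ∫ x, |Lb ((n:ℝ)⁻¹ • x)| * (C ^ 2 * (n:ℝ)⁻¹ ^ 4) := by
      refine norm_integral_le_of_norm_le hi (Eventually.of_forall fun x => ?_)
      by_cases hx : ‖x‖ < n
      · have : Lb ((n:ℝ)⁻¹ • x) = 0 := by
          apply hLb0
          rw [norm_smul, Real.norm_of_nonneg (by positivity), inv_mul_lt_iff₀ hn']
          simpa using hx
        simp [this]
      · push Not at hx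
        have h1 : |ψ x| ≤ C * (n:ℝ)⁻¹ := by
          refine (hdec x (hR.trans hx)).trans ?_
          rw [div_eq_mul_inv]
          exact mul_le_mul_of_nonneg_left (inv_anti₀ hn' hx) hC
        have h2 : |ψ x| * |ψ x| ≤ (C * (n:ℝ)⁻¹) * (C * (n:ℝ)⁻¹) :=
          mul_le_mul h1 h1 (abs_nonneg _) (by positivity)
        rw [Real.norm_eq_abs, abs_mul, abs_mul, abs_mul, abs_of_nonneg (by positivity : (0:ℝ) ≤ (n:ℝ)⁻¹ ^ 2)]
        calc |ψ x| * |ψ x| * ((n:ℝ)⁻¹ ^ 2 * |Lb ((n:ℝ)⁻¹ • x)|)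
            ≤ (C * (n:ℝ)⁻¹) * (C * (n:ℝ)⁻¹) * ((n:ℝ)⁻¹ ^ 2 * |Lb ((n:ℝ)⁻¹ • x)|) :=
              mul_le_mul_of_nonneg_right h2 (by positivity)
          _ = _ := by ring
    refine hle.trans (le_of_eq ?_)
    rw [hsc, integral_mul_const]
    simp only [finrank_euclideanSpace, Fintype.card_fin, smul_eq_mul]
    field_simp
  have hψF : Integrable (fun x => ψ x * F x) := npInt_left hψ.continuous hF hFs
  have hmain : Tendsto (fun n => ∫ x, χ n x * (ψ x * F x)) atTop (𝓝 (∫ x, ψ x * F x)) := by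
    refine tendsto_integral_of_dominated_convergence (fun x => ‖ψ x * F x‖) ?_ hψF.norm ?_ ?_
    · intro n
      exact ((hχ n).continuous.mul (hψ.continuous.mul hF)).aestronglyMeasurable
    · intro n
      refine Eventually.of_forall fun x => ?_
      rw [norm_mul, Real.norm_of_nonneg (hχ0 n x)]
      exact mul_le_of_le_one_left (norm_nonneg _) (hχ1 n x)
    · refine Eventually.of_forall fun x => ?_
      simpa using (hχlim x).mul_const (ψ x * F x)
  have htot : Tendsto (fun n => ∫ x, χ n x * g x) atTop (𝓝 (∫ x, ψ x * F x)) := by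
    have := hmain.add (herr.const_mul (1 / 2))
    simp only [mul_zero, add_zero] at this
    refine this.congr' ?_
    filter_upwards [eventually_gt_atTop 0] with n hn
    exact (npLocal hψ (hχ n) (hχs n hn) hF hL).symm
  have hgi : Integrable g := by
    refine (aecover_closedBall (x := (0 : NPE)) (μ := volume)
      (tendsto_natCast_atTop_atTop (R := ℝ))).integrable_of_integral_bounded_of_nonneg_ae
      ((∫ x, ψ x * F x) + 1) ?_ (Eventually.of_forall hg0) ?_
    · intro n
      exact hgc.continuousOn.integrableOn_compact (isCompact_closedBall _ _)
    · filter_upwards [eventually_gt_atTop 0, htot.eventually_le_const (lt_add_one _)] with n hn hle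
      refine le_trans ?_ hle
      have hint : Integrable (fun x => χ n x * g x) := by
        have := npInt_left hgc (hχ n).continuous (hχs n hn)
        exact this.congr (Eventually.of_forall fun x => mul_comm _ _)
      calc ∫ x in closedBall (0 : NPE) n, g x = ∫ x in closedBall (0 : NPE) n, χ n x * g x := by
            refine setIntegral_congr_fun measurableSet_closedBall fun x hx => ?_
            have hx' : ‖x‖ ≤ n := by simpa using hx
            simp only [hχeq n hn x hx', one_mul]
        _ ≤ ∫ x, χ n x * g x := setIntegral_le_integral hint
            (Eventually.of_forall fun x => mul_nonneg (hχ0 n x) (hg0 x))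
  refine ⟨hgi, ?_⟩
  have hlim : Tendsto (fun n => ∫ x, χ n x * g x) atTop (𝓝 (∫ x, g x)) := by
    refine tendsto_integral_of_dominated_convergence (fun x => ‖g x‖) ?_ hgi.norm ?_ ?_
    · intro n
      exact ((hχ n).continuous.mul hgc).aestronglyMeasurable
    · intro n
      refine Eventually.of_forall fun x => ?_
      rw [norm_mul, Real.norm_of_nonneg (hχ0 n x)]
      exact mul_le_of_le_one_left (norm_nonneg _) (hχ1 n x)
    · refine Eventually.of_forall fun x => ?_
      simpa using (hχlim x).mul_const (g x)
  exact tendsto_nhds_unique hlim htot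

lemma npGrad {ψ : NPE → ℝ} (x : NPE) : ‖gradient ψ x‖ ^ 2 = ∑ i, npD i ψ x ^ 2 := by
  rw [EuclideanSpace.norm_sq_eq]
  refine Finset.sum_congr rfl fun i _ => ?_
  have : (gradient ψ x) i = npD i ψ x := by
    have := inner_gradient_left (f := ψ) (x := x) (y := EuclideanSpace.single i (1:ℝ)) (𝕜 := ℝ)
    unfold npD
    rw [← this, EuclideanSpace.inner_single_right]; simp
  rw [this, Real.norm_eq_abs, sq_abs]

/-- For smooth compactly supported `u : ℝ³ → ℝ`, the Newtonian potential
`φ_u(x) = (1/(4π)) ∫ u(y)² / ‖x - y‖ dy` is differentiable, `‖∇φ_u‖²` and `φ_u u²`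
are integrable, and `∫ ‖∇φ_u‖² = ∫ φ_u u²`. -/
theorem newtonian_potential_energy_identity (u : EuclideanSpace ℝ (Fin 3) → ℝ)
    (hu : ContDiff ℝ (⊤ : ℕ∞) u) (hsupp : HasCompactSupport u)
    (φ : EuclideanSpace ℝ (Fin 3) → ℝ)
    (hφ : ∀ x : EuclideanSpace ℝ (Fin 3),
      φ x = (1 / (4 * Real.pi)) *
        ∫ y : EuclideanSpace ℝ (Fin 3), u y ^ 2 / ‖x - y‖) :
    Differentiable ℝ φ ∧
    Integrable (fun x : EuclideanSpace ℝ (Fin 3) => ‖gradient φ x‖ ^ 2) volume ∧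
    Integrable (fun x : EuclideanSpace ℝ (Fin 3) => φ x * u x ^ 2) volume ∧
    (∫ x : EuclideanSpace ℝ (Fin 3), ‖gradient φ x‖ ^ 2) =
      ∫ x : EuclideanSpace ℝ (Fin 3), φ x * u x ^ 2 := by
  have hf : ContDiff ℝ ∞ (fun y => u y ^ 2) := hu.pow 2
  have hfs : HasCompactSupport (fun y => u y ^ 2) :=
    hsupp.comp_left (g := fun r : ℝ => r ^ 2) (by simp)
  have hφ' : φ = fun x => (1 / (4 * Real.pi)) * npN (fun y => u y ^ 2) x := by
    funext x; rw [hφ, npN_swap]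
  have hN := npN_contDiff hf hfs
  have hφs : ContDiff ℝ ∞ φ := by rw [hφ']; exact contDiff_const.mul hN
  have hL : ∀ x, ∑ i, npD i (npD i φ) x = - (u x ^ 2) := by
    intro x
    have h1 : ∀ i, npD i (npD i φ) x =
        (1 / (4 * Real.pi)) * npD i (npD i (npN (fun y => u y ^ 2))) x := by
      intro i
      rw [hφ', npD_const_mul hN, npD_const_mul (npD_contDiff hN i)]
    simp only [h1]
    rw [← Finset.mul_sum, npLap_npN hf hfs]
    have := Real.pi_pos
    field_simp
  obtain ⟨C, R, hC, hR, hdec⟩ := npN_decay hf.continuous hfs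
  have hdec' : ∀ x, R ≤ ‖x‖ → |φ x| ≤ (1 / (4 * Real.pi) * C) / ‖x‖ := by
    intro x hx
    have hpi : 0 ≤ 1 / (4 * Real.pi) := by positivity
    rw [hφ', abs_mul, abs_of_nonneg hpi, mul_div_assoc]
    exact mul_le_mul_of_nonneg_left (hdec x hx) hpi
  obtain ⟨h1, h2⟩ := npGlobal hφs hf.continuous hfs hL (by positivity) hdec'
  refine ⟨hφs.differentiable (by simp), ?_, npInt_left hφs.continuous hf.continuous hfs, ?_⟩
  · simpa only [npGrad] using h1
  · simpa only [npGrad] using h2
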